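/- arXiv:2209.13606 — 2 statements merged into one kernel-verified Lean document; each statement's English description precedes it below -/
import Mathlib

section
/- Under the strengthened Lipschitz assumptions, for every t ∈ {1,…,T}, every node i_{t−1} ∈ V and every neighbor i_t ∈ N(i_{t−1}), the value functions x ↦ V_t(x, i_t) and x ↦ U_t(x, i_{t−1}) are Lipschitz continuous on Q_{t−1}^{(i_{t−1})} with Lipschitz constant L_{v,t} = L_c · Σ_{k=1}^{T−t+1} (1 + L_Θ)^k. -/
theorem aux_sInf_le {E : Type*} [MetricSpace E] (A A' : Set E) (hA : IsCompact A)
    (hA' : IsCompact A') (hne : A.Nonempty) (hne' : A'.Nonempty) (f f' : E → ℝ) (a b h : ℝ)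
    (hb : 0 ≤ b) (hd : Metric.hausdorffDist A A' ≤ h)
    (hf : ∀ y ∈ A, ∀ y' ∈ A', f y ≤ f' y' + a + b * dist y y')
    (hbd : BddBelow (f '' A)) :
    sInf (f '' A) ≤ sInf (f' '' A') + (a + b * h) := by
  rw [← sub_le_iff_le_add]
  apply le_csInf (hne'.image _)
  rintro _ ⟨y', hy', rfl⟩
  obtain ⟨y, hy, hyd⟩ := hA.exists_infDist_eq_dist hne y'
  have h1 : Metric.infDist y' A ≤ Metric.hausdorffDist A' A :=
    Metric.infDist_le_hausdorffDist_of_mem hy'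
      (Metric.hausdorffEDist_ne_top_of_nonempty_of_bounded hne' hne hA'.isBounded hA.isBounded)
  rw [Metric.hausdorffDist_comm] at h1
  have h2 : dist y y' ≤ h := by rw [dist_comm, ← hyd]; exact h1.trans hd
  have h3 := csInf_le hbd ⟨y, hy, rfl⟩
  have h4 := hf y hy y' hy'
  have h5 := mul_le_mul_of_nonneg_left h2 hb
  linarith

theorem aux_bdd {E : Type*} [MetricSpace E] (A A' : Set E) (hA : IsCompact A)
    (hne' : A'.Nonempty) (f f' : E → ℝ) (a b : ℝ) (hb : 0 ≤ b)
    (hf : ∀ y ∈ A, ∀ y' ∈ A', f' y' ≤ f y + a + b * dist y y') :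
    BddBelow (f '' A) := by
  obtain ⟨y', hy'⟩ := hne'
  obtain ⟨r, hr⟩ := hA.isBounded.subset_closedBall y'
  refine ⟨f' y' - a - b * r, ?_⟩
  rintro _ ⟨y, hy, rfl⟩
  have h1 : dist y y' ≤ r := hr hy
  have h2 := hf y hy y' hy'
  have h5 := mul_le_mul_of_nonneg_left h1 hb
  linarith

theorem aux_abs {E : Type*} [MetricSpace E] (A A' : Set E) (hA : IsCompact A)
    (hA' : IsCompact A') (hne : A.Nonempty) (hne' : A'.Nonempty) (f f' : E → ℝ) (a b h : ℝ)
    (hb : 0 ≤ b) (hd : Metric.hausdorffDist A A' ≤ h)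
    (hf : ∀ y ∈ A, ∀ y' ∈ A', |f y - f' y'| ≤ a + b * dist y y') :
    |sInf (f '' A) - sInf (f' '' A')| ≤ a + b * h := by
  have e1 : ∀ y ∈ A, ∀ y' ∈ A', f y ≤ f' y' + a + b * dist y y' := fun y hy y' hy' => by
    have := (abs_le.1 (hf y hy y' hy')).2
    linarith
  have e2 : ∀ y ∈ A, ∀ y' ∈ A', f' y' ≤ f y + a + b * dist y y' := fun y hy y' hy' => by
    have := (abs_le.1 (hf y hy y' hy')).1
    linarith
  have e3 : ∀ y' ∈ A', ∀ y ∈ A, f' y' ≤ f y + a + b * dist y' y := fun y' hy' y hy => by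
    rw [dist_comm]; exact e2 y hy y' hy'
  have e4 : ∀ y' ∈ A', ∀ y ∈ A, f y ≤ f' y' + a + b * dist y' y := fun y' hy' y hy => by
    rw [dist_comm]; exact e1 y hy y' hy'
  have b1 := aux_bdd A A' hA hne' f f' a b hb e2
  have b2 := aux_bdd A' A hA' hne f' f a b hb e4
  have c1 := aux_sInf_le A A' hA hA' hne hne' f f' a b h hb hd e1 b1
  have c2 := aux_sInf_le A' A hA' hA hne' hne f' f a b h hb
    (by rw [Metric.hausdorffDist_comm]; exact hd) e3 b2
  rw [abs_le]
  constructor <;> linarith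

theorem aux_sup {ι : Type*} (s : Finset ι) (hs : s.Nonempty) (f g : ι → ℝ) (C : ℝ)
    (h : ∀ j ∈ s, |f j - g j| ≤ C) : |s.sup' hs f - s.sup' hs g| ≤ C := by
  have key : ∀ f g : ι → ℝ, (∀ j ∈ s, |f j - g j| ≤ C) → s.sup' hs f ≤ s.sup' hs g + C := by
    intro f g h
    apply Finset.sup'_le
    intro j hj
    have h1 := Finset.le_sup' g hj
    have h2 := (abs_le.1 (h j hj)).2
    linarith
  have h1 := key f g h
  have h2 := key g f (fun j hj => by rw [abs_sub_comm]; exact h j hj)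
  rw [abs_le]
  constructor <;> linarith

theorem aux_geom (L : ℝ) (n : ℕ) :
    ∑ k ∈ Finset.Icc 1 (n + 1), (1 + L) ^ k
      = (1 + L) * (1 + ∑ k ∈ Finset.Icc 1 n, (1 + L) ^ k) := by
  induction n with
  | zero => simp
  | succ n ih =>
    have h := Finset.sum_Icc_succ_top (a := 1) (b := n) (by omega) (fun k => (1 + L) ^ k)
    rw [Finset.sum_Icc_succ_top (by omega), ih, ← ih, h]
    rw [h] at ih
    linear_combination ih

/-- Adversarial convex body chasing under the strengthened Lipschitz assumptions:
for every `t ∈ {1,…,T}`, node `i'` and neighbor `it ∈ N(i')`, the value functions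
`x ↦ V t x it` and `x ↦ U t x i'` are Lipschitz on `Q (t−1) i'` with constant
`L_{v,t} = L_c · Σ_{k=1}^{T−t+1} (1 + L_Θ)^k`. -/
theorem stmt_3 {N : ℕ} (X : Set (EuclideanSpace ℝ (Fin N)))
    {ι : Type*} [Fintype ι]
    (Nbr : ι → Finset ι) (hNbr : ∀ i, (Nbr i).Nonempty)
    (T : ℕ) (hT : 1 ≤ T)
    (Q : ℕ → ι → Set (EuclideanSpace ℝ (Fin N)))
    (hQne : ∀ t ≤ T, ∀ i, (Q t i).Nonempty)
    (hQcomp : ∀ t ≤ T, ∀ i, IsCompact (Q t i))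
    (hQconv : ∀ t ≤ T, ∀ i, Convex ℝ (Q t i))
    (hQsub : ∀ t ≤ T, ∀ i, Q t i ⊆ X)
    (R : EuclideanSpace ℝ (Fin N) → Set (EuclideanSpace ℝ (Fin N)))
    (hRcomp : ∀ x ∈ X, IsCompact (R x))
    (hRsub : ∀ x ∈ X, R x ⊆ X)
    (hRcont : ∀ x ∈ X, ∀ ε > (0 : ℝ), ∃ δ > (0 : ℝ), ∀ x' ∈ X, dist x x' < δ →
        Metric.hausdorffDist (R x) (R x') < ε)
    (c : EuclideanSpace ℝ (Fin N) → EuclideanSpace ℝ (Fin N) → ℝ)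
    (hcnonneg : ∀ x ∈ X, ∀ y ∈ X, 0 ≤ c x y)
    (Lc LΘ : ℝ) (hLc : 0 ≤ Lc) (hLΘ : 0 ≤ LΘ)
    (hcLip : ∀ x ∈ X, ∀ x' ∈ X, ∀ y ∈ X, ∀ y' ∈ X,
        |c x y - c x' y'| ≤ Lc * (dist x x' + dist y y'))
    (hΘLip : ∀ t ≤ T, ∀ i : ι, ∀ x ∈ X, ∀ x' ∈ X,
        (R x ∩ Q t i).Nonempty → (R x' ∩ Q t i).Nonempty →
        Metric.hausdorffDist (R x ∩ Q t i) (R x' ∩ Q t i) ≤ LΘ * dist x x')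
    (hfeas : ∀ t < T, ∀ i, ∀ x ∈ Q t i, ∀ j ∈ Nbr i,
        (interior (R x ∩ Q (t + 1) j)).Nonempty)
    (V U : ℕ → EuclideanSpace ℝ (Fin N) → ι → ℝ)
    (hVT : ∀ x i, V T x i = sInf ((fun y => c x y) '' (R x ∩ Q T i)))
    (hVt : ∀ t, 1 ≤ t → t < T → ∀ x i,
        V t x i = sInf ((fun y =>
          c x y + (Nbr i).sup' (hNbr i) (fun j => V (t + 1) y j)) '' (R x ∩ Q t i)))
    (hUT : ∀ x i, U T x i =
        (Nbr i).sup' (hNbr i) (fun j => sInf ((fun y => c x y) '' (R x ∩ Q T j))))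
    (hUt : ∀ t, 1 ≤ t → t < T → ∀ x i,
        U t x i = (Nbr i).sup' (hNbr i) (fun j =>
          sInf ((fun y => c x y + U (t + 1) y j) '' (R x ∩ Q t j))))
    (t : ℕ) (ht1 : 1 ≤ t) (htT : t ≤ T)
    (i' it : ι) (hit : it ∈ Nbr i') :
    ∀ x ∈ Q (t - 1) i', ∀ x' ∈ Q (t - 1) i',
      |V t x it - V t x' it|
          ≤ (Lc * ∑ k ∈ Finset.Icc 1 (T - t + 1), (1 + LΘ) ^ k) * dist x x' ∧
      |U t x i' - U t x' i'|
          ≤ (Lc * ∑ k ∈ Finset.Icc 1 (T - t + 1), (1 + LΘ) ^ k) * dist x x' := by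
  have hstep : ∀ (W : EuclideanSpace ℝ (Fin N) → ℝ) (K : ℝ) (t : ℕ) (j : ι), 0 ≤ K → t ≤ T →
      (∀ y ∈ Q t j, ∀ y' ∈ Q t j, |W y - W y'| ≤ K * dist y y') →
      ∀ x ∈ X, ∀ x' ∈ X, (R x ∩ Q t j).Nonempty → (R x' ∩ Q t j).Nonempty →
      |sInf ((fun y => c x y + W y) '' (R x ∩ Q t j))
        - sInf ((fun y => c x' y + W y) '' (R x' ∩ Q t j))|
        ≤ ((1 + LΘ) * (Lc + K)) * dist x x' := by
    intro W K t j hK ht hW x hx x' hx' hne hne'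
    have hcl := (hQcomp t ht j).isClosed
    have := aux_abs (R x ∩ Q t j) (R x' ∩ Q t j) ((hRcomp x hx).inter_right hcl)
      ((hRcomp x' hx').inter_right hcl) hne hne' (fun y => c x y + W y)
      (fun y => c x' y + W y) (Lc * dist x x') (Lc + K) (LΘ * dist x x') (by linarith)
      (hΘLip t ht j x hx x' hx' hne hne') (by
        intro y hy y' hy'
        have h1 := hcLip x hx x' hx' y (hRsub x hx hy.1) y' (hRsub x' hx' hy'.1)
        have h2 := hW y hy.2 y' hy'.2
        rw [abs_le] at h1 h2 ⊢
        constructor <;> nlinarith)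
    refine this.trans ?_
    have h3 : 0 ≤ K * dist x x' := mul_nonneg hK dist_nonneg
    nlinarith
  have hS : ∀ n, 0 ≤ Lc * ∑ k ∈ Finset.Icc 1 n, (1 + LΘ) ^ k := fun n =>
    mul_nonneg hLc (Finset.sum_nonneg fun k _ => by positivity)
  have hgeom : ∀ n, (1 + LΘ) * (Lc + Lc * ∑ k ∈ Finset.Icc 1 n, (1 + LΘ) ^ k)
      = Lc * ∑ k ∈ Finset.Icc 1 (n + 1), (1 + LΘ) ^ k := fun n => by
    rw [aux_geom]; ring
  have hne : ∀ t, 1 ≤ t → t ≤ T → ∀ i, ∀ x ∈ Q (t - 1) i, ∀ j ∈ Nbr i,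
      (R x ∩ Q t j).Nonempty := by
    intro t h1 h2 i x hx j hj
    have := (hfeas (t - 1) (by omega) i x hx j hj).mono interior_subset
    rwa [Nat.sub_add_cancel h1] at this
  have main : ∀ n t, 1 ≤ t → t + n = T → ∀ i, ∀ x ∈ Q (t - 1) i, ∀ x' ∈ Q (t - 1) i,
      (∀ j ∈ Nbr i, |V t x j - V t x' j|
          ≤ (Lc * ∑ k ∈ Finset.Icc 1 (n + 1), (1 + LΘ) ^ k) * dist x x') ∧
      |U t x i - U t x' i|
          ≤ (Lc * ∑ k ∈ Finset.Icc 1 (n + 1), (1 + LΘ) ^ k) * dist x x' := by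
    intro n
    induction n with
    | zero =>
      intro t h1 h2 i x hx x' hx'
      obtain rfl : t = T := by omega
      have hxX := hQsub (t - 1) (by omega) i hx
      have hxX' := hQsub (t - 1) (by omega) i hx'
      have key : ∀ j ∈ Nbr i, |sInf ((fun y => c x y) '' (R x ∩ Q t j))
          - sInf ((fun y => c x' y) '' (R x' ∩ Q t j))|
          ≤ (Lc * ∑ k ∈ Finset.Icc 1 (0 + 1), (1 + LΘ) ^ k) * dist x x' := by
        intro j hj
        have := hstep (fun _ => 0) 0 t j le_rfl le_rfl (by simp) x hxX x' hxX'
          (hne t h1 le_rfl i x hx j hj) (hne t h1 le_rfl i x' hx' j hj)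
        rw [← hgeom 0]
        simpa using this
      refine ⟨fun j hj => ?_, ?_⟩
      · rw [hVT, hVT]; exact key j hj
      · rw [hUT, hUT]; exact aux_sup _ _ _ _ _ key
    | succ n ih =>
      intro t h1 h2 i x hx x' hx'
      have hxX := hQsub (t - 1) (by omega) i hx
      have hxX' := hQsub (t - 1) (by omega) i hx'
      have ih' := ih (t + 1) (by omega) (by omega)
      rw [Nat.add_sub_cancel] at ih'
      refine ⟨fun j hj => ?_, ?_⟩
      · rw [hVt t h1 (by omega), hVt t h1 (by omega), ← hgeom (n + 1)]
        exact hstep (fun y => (Nbr j).sup' (hNbr j) (fun j => V (t + 1) y j)) _ t j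
          (hS (n + 1)) (by omega)
          (fun y hy y' hy' => aux_sup _ _ _ _ _ (ih' j y hy y' hy').1) x hxX x' hxX'
          (hne t h1 (by omega) i x hx j hj) (hne t h1 (by omega) i x' hx' j hj)
      · rw [hUt t h1 (by omega), hUt t h1 (by omega), ← hgeom (n + 1)]
        refine aux_sup _ _ _ _ _ fun j hj => ?_
        exact hstep (fun y => U (t + 1) y j) _ t j
          (hS (n + 1)) (by omega)
          (fun y hy y' hy' => (ih' j y hy y' hy').2) x hxX x' hxX'
          (hne t h1 (by omega) i x hx j hj) (hne t h1 (by omega) i x' hx' j hj)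
  intro x hx x' hx'
  have := main (T - t) t ht1 (by omega) i' x hx x' hx'
  exact ⟨this.1 it hit, this.2⟩
end

section
/- Let Γ : X → subsets of Y be a correspondence such that Γ(x) is nonempty and compact for every x, and Γ is continuous with respect to the Hausdorff distance; let Q ⊆ Y be a nonempty compact set; and assume Γ(x) ∩ Q is convex for every x. Then the intersection correspondence Θ(x) = Γ(x) ∩ Q is continuous with respect to the Hausdorff distance on the set D = { x ∈ X : the interior of Γ(x) ∩ Q is nonempty }. -/
/-- Let `Γ` be a nonempty-compact-valued correspondence on `X ⊆ ℝ^d`, continuous with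
respect to the Hausdorff distance, let `Q ⊆ Y` be nonempty and compact, and assume
`Γ(x) ∩ Q` is convex for every `x`. Then the intersection correspondence
`Θ(x) = Γ(x) ∩ Q` is continuous with respect to the Hausdorff distance on
`D = { x ∈ X : interior (Γ(x) ∩ Q) ≠ ∅ }`. -/
theorem stmt_6 {d : ℕ} (X Y : Set (EuclideanSpace ℝ (Fin d)))
    (Γ : EuclideanSpace ℝ (Fin d) → Set (EuclideanSpace ℝ (Fin d)))
    (hΓsub : ∀ x ∈ X, Γ x ⊆ Y)
    (hΓne : ∀ x ∈ X, (Γ x).Nonempty)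
    (hΓcomp : ∀ x ∈ X, IsCompact (Γ x))
    (hΓcont : ∀ x ∈ X, ∀ ε > (0 : ℝ), ∃ δ > (0 : ℝ), ∀ x' ∈ X, dist x x' < δ →
        Metric.hausdorffDist (Γ x) (Γ x') < ε)
    (Q : Set (EuclideanSpace ℝ (Fin d)))
    (hQne : Q.Nonempty) (hQcomp : IsCompact Q) (hQsub : Q ⊆ Y)
    (hconv : ∀ x ∈ X, Convex ℝ (Γ x ∩ Q)) :
    ∀ x ∈ {z ∈ X | (interior (Γ z ∩ Q)).Nonempty}, ∀ ε > (0 : ℝ), ∃ δ > (0 : ℝ),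
      ∀ x' ∈ {z ∈ X | (interior (Γ z ∩ Q)).Nonempty}, dist x x' < δ →
        Metric.hausdorffDist (Γ x ∩ Q) (Γ x' ∩ Q) < ε := by
  rintro x ⟨hx, z0, hz0⟩ ε hε
  have hKc : IsCompact (Γ x ∩ Q) := (hΓcomp x hx).inter hQcomp
  have hKne : (Γ x ∩ Q).Nonempty := ⟨z0, interior_subset hz0⟩
  have hz0K := interior_subset hz0
  obtain ⟨r, hr, hball⟩ := Metric.isOpen_iff.1 isOpen_interior z0 hz0
  -- upper part
  have hup : ∃ η > (0 : ℝ), ∀ p ∈ Q, Metric.infDist p (Γ x) < η →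
      Metric.infDist p (Γ x ∩ Q) < ε / 2 := by
    have hS : IsCompact (Q ∩ {p | ε / 2 ≤ Metric.infDist p (Γ x ∩ Q)}) :=
      hQcomp.inter_right
        (isClosed_le continuous_const (Metric.continuous_infDist_pt _))
    obtain ⟨η, hη, h⟩ := hS.exists_forall_le' (a := (0 : ℝ))
      (Metric.continuous_infDist_pt (Γ x)).continuousOn (by
        rintro p ⟨hpQ, hp⟩
        by_contra hcon
        have h0 : Metric.infDist p (Γ x) = 0 :=
          le_antisymm (not_lt.1 hcon) Metric.infDist_nonneg
        have hpm : p ∈ Γ x :=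
          ((hΓcomp x hx).isClosed.mem_iff_infDist_zero (hΓne x hx)).2 h0
        have : Metric.infDist p (Γ x ∩ Q) = 0 := Metric.infDist_zero_of_mem ⟨hpm, hpQ⟩
        have hp' : ε / 2 ≤ Metric.infDist p (Γ x ∩ Q) := hp
        linarith)
    refine ⟨η, hη, fun p hpQ hp => ?_⟩
    by_contra hcon
    exact absurd (h p ⟨hpQ, not_lt.1 hcon⟩) (not_le.2 hp)
  obtain ⟨η, hη, hup⟩ := hup
  -- lower part
  obtain ⟨M, hM⟩ := Metric.isBounded_iff.1 hKc.isBounded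
  have hM0 : 0 ≤ M := dist_nonneg.trans (hM hz0K hz0K)
  obtain ⟨t, ht, ht1, htM⟩ : ∃ t : ℝ, 0 < t ∧ t ≤ 1 ∧ t * (r + M) ≤ ε / 2 := by
    have hpos : 0 < r + M := by linarith
    refine ⟨min 1 (ε / 2 / (r + M)), by positivity, min_le_left _ _, ?_⟩
    exact (le_div_iff₀ hpos).1 (min_le_right _ _)
  obtain ⟨δ, hδ, hcont⟩ := hΓcont x hx (min η (t * r)) (by positivity)
  refine ⟨δ, hδ, ?_⟩
  rintro x' ⟨hx', -⟩ hd
  have hH := hcont x' hx' hd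
  have hfin := Metric.hausdorffEDist_ne_top_of_nonempty_of_bounded (hΓne x hx) (hΓne x' hx')
    (hΓcomp x hx).isBounded (hΓcomp x' hx').isBounded
  refine lt_of_le_of_lt (Metric.hausdorffDist_le_of_mem_dist (r := ε / 2) (by positivity)
    ?_ ?_) (half_lt_self hε)
  · intro y hy
    have hz : (1 - t) • y + t • z0 ∈ Γ x ∩ Q :=
      hconv x hx hy hz0K (by linarith) ht.le (by ring)
    obtain ⟨p, hp, hpd⟩ := Metric.exists_dist_lt_of_hausdorffDist_lt hz.1
      (hH.trans_le (min_le_right _ _)) hfin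
    have hu : z0 + t⁻¹ • (p - ((1 - t) • y + t • z0)) ∈ Γ x ∩ Q := by
      apply interior_subset
      apply hball
      rw [mem_ball_iff_norm, add_sub_cancel_left, norm_smul, Real.norm_eq_abs,
        abs_of_pos (inv_pos.2 ht), inv_mul_lt_iff₀ ht, ← dist_eq_norm, dist_comm]
      exact hpd
    have hpe : (1 - t) • y + t • (z0 + t⁻¹ • (p - ((1 - t) • y + t • z0))) = p := by
      rw [smul_add, smul_inv_smul₀ ht.ne']
      abel
    have hpK : p ∈ Γ x ∩ Q := by
      rw [← hpe]
      exact hconv x hx hy hu (by linarith) ht.le (by ring)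
    refine ⟨p, ⟨hp, hpK.2⟩, ?_⟩
    have h1 : dist y ((1 - t) • y + t • z0) ≤ t * M := by
      have : y - ((1 - t) • y + t • z0) = t • (y - z0) := by module
      rw [dist_eq_norm, this, norm_smul, Real.norm_eq_abs, abs_of_pos ht, ← dist_eq_norm]
      exact mul_le_mul_of_nonneg_left (hM hy hz0K) ht.le
    have h2 := dist_triangle y ((1 - t) • y + t • z0) p
    nlinarith
  · rintro p ⟨hp, hpQ⟩
    obtain ⟨q, hq, hqd⟩ := Metric.exists_dist_lt_of_hausdorffDist_lt' hp
      (hH.trans_le (min_le_left _ _)) hfin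
    have h1 := hup p hpQ ((Metric.infDist_le_dist_of_mem hq).trans_lt
      (by rwa [dist_comm] at hqd))
    obtain ⟨w, hw, hwd⟩ := (Metric.infDist_lt_iff hKne).1 h1
    exact ⟨w, hw, hwd.le⟩
end
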